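/- With the discharging setup below, for each y ∈ Y one has M₂*(y) ≥ 0 = M₂(y). -/

import Mathlib

open Finset

variable {V : Type*}

/-- `φ` is a proper edge coloring of `G` with colors in `{1, …, k}`, encoded as a symmetric
function on ordered pairs of vertices: every edge receives a color in `[1,k]` and two distinct
edges sharing a vertex receive different colors. -/
def IsEdgeColoring (G : SimpleGraph V) (k : ℕ) (φ : V → V → ℕ) : Prop :=
  (∀ u v, φ u v = φ v u) ∧
  (∀ ⦃u v⦄, G.Adj u v → φ u v ∈ Finset.Icc 1 k) ∧
  (∀ ⦃v a b⦄, G.Adj v a → G.Adj v b → a ≠ b → φ v a ≠ φ v b)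

/-- The chromatic index of `G`: the least `k` such that `G` has a proper edge `k`-coloring. -/
noncomputable def chromIndex (G : SimpleGraph V) : ℕ :=
  sInf {k | ∃ φ : V → V → ℕ, IsEdgeColoring G k φ}

/-- `G` is `Δ`-critical: `G` is connected, `χ'(G) = Δ + 1`, and `χ'(G - e) = Δ` for every
edge `e` of `G`, where `Δ` is the maximum degree of `G`. -/
def IsDeltaCritical [Fintype V] (G : SimpleGraph V) [DecidableRel G.Adj] : Prop :=
  G.Connected ∧ chromIndex G = G.maxDegree + 1 ∧
    ∀ e ∈ G.edgeSet, chromIndex (G.deleteEdges {e}) = G.maxDegree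

/-- The independence number of `G`. -/
noncomputable def indepNum [Fintype V] (G : SimpleGraph V) : ℕ :=
  sSup {n | ∃ s : Finset V, (∀ u ∈ s, ∀ v ∈ s, u ≠ v → ¬ G.Adj u v) ∧ s.card = n}

noncomputable section

open scoped Classical

variable [Fintype V]

/-- `g₁(k) = (d+2)(Δ-k)/k`. -/
def g1 (d : ℕ) (Δ k : ℝ) : ℝ := ((d : ℝ) + 2) * (Δ - k) / k

/-- The set `X⁺ = {x ∈ X : q ≤ d(x) < Δ}`. -/
def Xp (G : SimpleGraph V) [DecidableRel G.Adj] (q : ℝ) (X : Finset V) : Finset V :=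
  X.filter fun x => q ≤ (G.degree x : ℝ) ∧ G.degree x < G.maxDegree

/-- The set `X⁻ = {x ∈ X : d ≤ d(x) < q}`. -/
def Xm (G : SimpleGraph V) [DecidableRel G.Adj] (d : ℕ) (q : ℝ) (X : Finset V) : Finset V :=
  X.filter fun x => d ≤ G.degree x ∧ (G.degree x : ℝ) < q

/-- The charge `M₁*(y)` of a vertex `y ∈ Y` after Step 1 of the discharging rule: starting
from `M₁(y) = ωΔ`, the vertex `y` gives charge `g₁(d(x))` to each `x ∈ N(y) ∩ X⁺`. -/
def M1star (G : SimpleGraph V) [DecidableRel G.Adj] (d : ℕ) (ω q : ℝ) (X : Finset V)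
    (y : V) : ℝ :=
  ω * G.maxDegree -
    ∑ x ∈ G.neighborFinset y ∩ Xp G q X, g1 d (G.maxDegree : ℝ) (G.degree x : ℝ)

/-- The charge that `y ∈ Y` gives to each vertex of `N(y) ∩ X⁻` in Step 2 of the discharging
rule: if `M₁*(y) > 0`, then `y` distributes its remaining charge equally among all vertices
(if any) of `N(y) ∩ X⁻`. -/
def step2 (G : SimpleGraph V) [DecidableRel G.Adj] (d : ℕ) (ω q : ℝ) (X : Finset V)
    (y : V) : ℝ :=
  if 0 < M1star G d ω q X y ∧ (G.neighborFinset y ∩ Xm G d q X).Nonempty then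
    M1star G d ω q X y / ((G.neighborFinset y ∩ Xm G d q X).card : ℝ)
  else 0

/-- The final charge `M₂*(y)` of a vertex `y ∈ Y`. -/
def M2starY (G : SimpleGraph V) [DecidableRel G.Adj] (d : ℕ) (ω q : ℝ) (X : Finset V)
    (y : V) : ℝ :=
  M1star G d ω q X y - ((G.neighborFinset y ∩ Xm G d q X).card : ℝ) * step2 G d ω q X y

/-- The final charge `M₂*(x)` of a vertex `x ∈ X`: starting from `M₁(x) = (d+2)d(x)`,
`x` receives `g₁(d(x))` from each neighbor `y ∈ Y` in Step 1 if `x ∈ X⁺`, and receives the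
Step-2 charge from each neighbor `y ∈ Y` if `x ∈ X⁻`. -/
def M2starX (G : SimpleGraph V) [DecidableRel G.Adj] (d : ℕ) (ω q : ℝ) (X : Finset V)
    (x : V) : ℝ :=
  ((d : ℝ) + 2) * G.degree x +
    (if x ∈ Xp G q X then
      ∑ y ∈ (G.neighborFinset x).filter (· ∉ X), g1 d (G.maxDegree : ℝ) (G.degree x : ℝ)
    else 0) +
    (if x ∈ Xm G d q X then
      ∑ y ∈ (G.neighborFinset x).filter (· ∉ X), step2 G d ω q X y
    else 0)

/-- `σ_q(x,z) = |{u ∈ N(z) - {x} : d(u) ≥ q}|`. -/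
def sigmaq (G : SimpleGraph V) [DecidableRel G.Adj] (q : ℝ) (x z : V) : ℕ :=
  ((G.neighborFinset z).filter fun u => u ≠ x ∧ q ≤ (G.degree u : ℝ)).card

end

variable [Fintype V]

/-- Color `c ∈ [1,k]` is missing at `v`. -/
def Miss {V : Type*} (H : SimpleGraph V) (k : ℕ) (φ : V → V → ℕ) (v : V) (c : ℕ) : Prop :=
  c ∈ Finset.Icc 1 k ∧ ∀ u, H.Adj v u → φ v u ≠ c

/-- Vertices reachable in `n` fan steps from `x` around `y`. -/
def FanR {V : Type*} (H : SimpleGraph V) (k : ℕ) (φ : V → V → ℕ) (x y : V) : ℕ → V → Prop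
  | 0, v => v = x
  | n + 1, w => ∃ z, FanR H k φ x y n z ∧ H.Adj y w ∧ Miss H k φ z (φ y w)

theorem FanR.ne {V : Type*} {H : SimpleGraph V} {k : ℕ} {φ : V → V → ℕ} {x y : V}
    (hxy : x ≠ y) {n : ℕ} {v : V} (h : FanR H k φ x y n v) : v ≠ y := by
  cases n with
  | zero => simp only [FanR] at h; subst h; exact hxy
  | succ n => obtain ⟨z, _, h, _⟩ := h; exact h.ne'

theorem fan_disjoint_center {V : Type*} (H : SimpleGraph V) (k : ℕ) (x y : V) (hxy : x ≠ y)
    (hno : ∀ φ, IsEdgeColoring H k φ → ∀ c, Miss H k φ x c → ¬ Miss H k φ y c) :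
    ∀ n φ, IsEdgeColoring H k φ → ∀ v, FanR H k φ x y n v → ∀ c, Miss H k φ v c →
      ¬ Miss H k φ y c := by
  classical
  intro n
  induction n using Nat.strong_induction_on with
  | _ n ih =>
  intro φ hφ v hv a hva hya
  by_cases hmin : ∃ m < n, FanR H k φ x y m v
  · obtain ⟨m, hm, h⟩ := hmin
    exact ih m hm φ hφ v h a hva hya
  cases n with
  | zero => simp only [FanR] at hv; subst hv; exact hno φ hφ a hva hya
  | succ n =>
  have hmin' : ∀ m ≤ n, ∀ u, FanR H k φ x y m u → u ≠ v := by
    rintro m hm u hu rfl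
    exact hmin ⟨m, by omega, hu⟩
  obtain ⟨z, hz, hyv, hzc⟩ := hv
  obtain ⟨hs, hr, hp⟩ := hφ
  let ψ : V → V → ℕ := fun u w => if (u = y ∧ w = v) ∨ (u = v ∧ w = y) then a else φ u w
  have hvy : v ≠ y := hyv.ne'
  have hψ0 : ∀ u w, u ≠ y → u ≠ v → ψ u w = φ u w := by
    intro u w h1 h2; simp [ψ, h1, h2]
  have hψ1 : ∀ w, w ≠ v → ψ y w = φ y w := by
    intro w h1; simp [ψ, h1, hvy.symm]
  have hψ2 : ψ y v = a := by simp [ψ]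
  have hψ3 : ψ v y = a := by simp [ψ]
  have hψ4 : ∀ w, w ≠ y → ψ v w = φ v w := by
    intro w h1; simp [ψ, h1, hvy]
  have hψ : IsEdgeColoring H k ψ := by
    refine ⟨?_, ?_, ?_⟩
    · intro u w
      simp only [ψ, hs u w]
      congr 1
      apply propext; tauto
    · intro u w huw
      simp only [ψ]
      split_ifs
      · exact hya.1
      · exact hr huw
    · intro u b c hb hc hbc
      by_cases h1 : u = y
      · subst h1
        by_cases h2 : b = v
        · subst h2
          rw [hψ2, hψ1 c hbc.symm]; exact (hya.2 c hc).symm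
        · by_cases h3 : c = v
          · subst h3
            rw [hψ2, hψ1 b hbc]; exact hya.2 b hb
          · rw [hψ1 b h2, hψ1 c h3]; exact hp hb hc hbc
      · by_cases h1' : u = v
        · subst h1'
          by_cases h2 : b = y
          · subst h2
            rw [hψ3, hψ4 c hbc.symm]; exact (hva.2 c hc).symm
          · by_cases h3 : c = y
            · subst h3
              rw [hψ3, hψ4 b hbc]; exact hva.2 b hb
            · rw [hψ4 b h2, hψ4 c h3]; exact hp hb hc hbc
        · rw [hψ0 u b h1 h1', hψ0 u c h1 h1']; exact hp hb hc hbc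
  have hmiss : ∀ u c, u ≠ y → u ≠ v → Miss H k φ u c → Miss H k ψ u c := by
    intro u c h1 h2 h
    refine ⟨h.1, fun w hw => ?_⟩
    rw [hψ0 u w h1 h2]; exact h.2 w hw
  have hreach : ∀ m ≤ n, ∀ u, FanR H k φ x y m u → FanR H k ψ x y m u := by
    intro m
    induction m with
    | zero => intro _ u hu; exact hu
    | succ m ihm =>
      intro hm u hu
      have huv := hmin' _ hm u hu
      obtain ⟨t, ht, hyu, htc⟩ := hu
      refine ⟨t, ihm (by omega) t ht, hyu, ?_⟩
      rw [hψ1 u huv]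
      exact hmiss t _ (ht.ne hxy) (hmin' m (by omega) t ht) htc
  refine ih n (by omega) ψ hψ z (hreach n le_rfl z hz) (φ y v)
    (hmiss z _ (hz.ne hxy) (hmin' n le_rfl z hz) hzc) ⟨hzc.1, fun w hw => ?_⟩
  by_cases h : w = v
  · subst h; rw [hψ2]; exact (hya.2 w hw).symm
  · rw [hψ1 w h]; exact hp hw hyv h

/-- Kempe subgraph. -/
def Kempe {V : Type*} (H : SimpleGraph V) (φ : V → V → ℕ) (hs : ∀ u v, φ u v = φ v u)
    (a b : ℕ) : SimpleGraph V where
  Adj u v := H.Adj u v ∧ (φ u v = a ∨ φ u v = b)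
  symm := ⟨fun u v h => ⟨h.1.symm, by rw [hs v u]; exact h.2⟩⟩
  loopless := ⟨fun u h => H.loopless.irrefl u h.1⟩

theorem three_ends {V : Type*} [Fintype V] (K : SimpleGraph V)
    (h2 : ∀ u, ∀ s : Finset V, (∀ w ∈ s, K.Adj u w) → s.card ≤ 2)
    (y z w : V) (hyz : y ≠ z) (hyw : y ≠ w) (hzw : z ≠ w)
    (h1 : ∀ u, u = y ∨ u = z ∨ u = w → ∀ s : Finset V, (∀ w ∈ s, K.Adj u w) → s.card ≤ 1)
    (rz : K.Reachable y z) (rw' : K.Reachable y w) : False := by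
  classical
  let C := K.connectedComponentMk y
  have hconn : C.toSimpleGraph.Connected := C.connected_toSimpleGraph
  have hE := hconn.card_vert_le_card_edgeSet_add_one
  have hsum := C.toSimpleGraph.sum_degrees_eq_twice_card_edges
  rw [Nat.card_eq_fintype_card, Nat.card_eq_fintype_card, ← SimpleGraph.edgeFinset_card] at hE
  have hdeg : ∀ u : C, ∃ s : Finset V, (∀ w ∈ s, K.Adj u w) ∧
      s.card = C.toSimpleGraph.degree u := by
    intro u
    refine ⟨(C.toSimpleGraph.neighborFinset u).map ⟨Subtype.val, Subtype.val_injective⟩, ?_, ?_⟩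
    · intro w hw
      simp only [Finset.mem_map, SimpleGraph.mem_neighborFinset] at hw
      obtain ⟨t, ht, rfl⟩ := hw
      exact ht
    · rw [Finset.card_map, SimpleGraph.card_neighborFinset_eq_degree]
  let T : Finset C := {⟨y, rfl⟩,
    ⟨z, SimpleGraph.ConnectedComponent.eq.2 rz.symm⟩,
    ⟨w, SimpleGraph.ConnectedComponent.eq.2 rw'.symm⟩}
  have hT : T.card = 3 := by
    rw [Finset.card_eq_three]
    exact ⟨_, _, _, fun h => hyz (congrArg Subtype.val h), fun h => hyw (congrArg Subtype.val h), fun h => hzw (congrArg Subtype.val h), rfl⟩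
  have hle : ∀ u : C, C.toSimpleGraph.degree u + (if u ∈ T then 1 else 0) ≤ 2 := by
    intro u
    obtain ⟨s, hs, hc⟩ := hdeg u
    split_ifs with hu
    · have : s.card ≤ 1 := by
        apply h1 u _ s hs
        simp only [T, Finset.mem_insert, Finset.mem_singleton] at hu
        rcases hu with h | h | h <;> rw [h] <;> simp
      omega
    · have := h2 u s hs
      omega
  have := Finset.sum_le_sum (fun u (_ : u ∈ Finset.univ) => hle u)
  rw [Finset.sum_add_distrib, hsum] at this
  simp only [Finset.sum_ite_mem, Finset.univ_inter, Finset.sum_const, smul_eq_mul, hT,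
    Finset.card_univ] at this
  omega

theorem fan_disjoint {V : Type*} [Fintype V] (H : SimpleGraph V) (k : ℕ) (x y : V) (hxy : x ≠ y)
    (hno : ∀ φ, IsEdgeColoring H k φ → ∀ c, Miss H k φ x c → ¬ Miss H k φ y c)
    (φ : V → V → ℕ) (hφ : IsEdgeColoring H k φ) (b : ℕ) (hb : Miss H k φ y b)
    (a : ℕ) (z w : V) (hzw : z ≠ w) (nz nw : ℕ) (hz : FanR H k φ x y nz z)
    (hw : FanR H k φ x y nw w) (hza : Miss H k φ z a) (hwa : Miss H k φ w a) : False := by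
  classical
  have hA := fan_disjoint_center H k x y hxy hno
  have hs := hφ.1
  let K := Kempe H φ hs a b
  have hya : ¬ Miss H k φ y a := hA _ φ hφ z hz a hza
  have hab : a ≠ b := by rintro rfl; exact hya hb
  have hinj : ∀ u, ∀ s : Finset V, (∀ w ∈ s, K.Adj u w) → Set.InjOn (φ u) s := by
    intro u s h p hp r hr hpr
    by_contra hne
    exact hφ.2.2 (h p hp).1 (h r hr).1 hne hpr
  have h2 : ∀ u, ∀ s : Finset V, (∀ w ∈ s, K.Adj u w) → s.card ≤ 2 := by
    intro u s h
    rw [← Finset.card_image_of_injOn (hinj u s h)]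
    refine (Finset.card_le_card (t := {a, b}) ?_).trans Finset.card_le_two
    intro c hc
    obtain ⟨t, ht, rfl⟩ := Finset.mem_image.1 hc
    simpa using (h t ht).2
  have h1a : ∀ u, Miss H k φ u a → ∀ s : Finset V, (∀ w ∈ s, K.Adj u w) → s.card ≤ 1 := by
    intro u hu s h
    rw [← Finset.card_image_of_injOn (hinj u s h)]
    refine (Finset.card_le_card (t := {b}) ?_).trans (by simp)
    intro c hc
    obtain ⟨t, ht, rfl⟩ := Finset.mem_image.1 hc
    simpa [hu.2 t (h t ht).1] using (h t ht).2
  have h1b : ∀ u, Miss H k φ u b → ∀ s : Finset V, (∀ w ∈ s, K.Adj u w) → s.card ≤ 1 := by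
    intro u hu s h
    rw [← Finset.card_image_of_injOn (hinj u s h)]
    refine (Finset.card_le_card (t := {a}) ?_).trans (by simp)
    intro c hc
    obtain ⟨t, ht, rfl⟩ := Finset.mem_image.1 hc
    simpa [hu.2 t (h t ht).1] using (h t ht).2
  -- some fan vertex missing `a` outside the component of `y`
  have hex : ∃ n, ∃ v, FanR H k φ x y n v ∧ Miss H k φ v a ∧ ¬ K.Reachable y v := by
    by_contra hcon
    push Not at hcon
    refine three_ends K h2 y z w (hz.ne hxy).symm (hw.ne hxy).symm hzw ?_
      (hcon _ z hz hza) (hcon _ w hw hwa)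
    rintro u (rfl | rfl | rfl)
    · exact h1b _ hb
    · exact h1a _ hza
    · exact h1a _ hwa
  obtain ⟨v, hv, hva, hyv⟩ := Nat.find_spec hex
  have hminl : ∀ m < Nat.find hex, ∀ u, FanR H k φ x y m u → Miss H k φ u a →
      K.Reachable y u := by
    intro m hm u hu hua
    by_contra h
    exact Nat.find_min hex hm ⟨u, hu, hua, h⟩
  generalize Nat.find hex = n at hv hminl
  let σ := Equiv.swap a b
  let ψ : V → V → ℕ := fun u t => if K.Adj u t ∧ K.Reachable v u then σ (φ u t) else φ u t
  have hin : ∀ u t, K.Reachable v u → H.Adj u t → ψ u t = σ (φ u t) := by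
    intro u t h1 h2
    by_cases h : K.Adj u t
    · simp only [ψ, h, h1, and_self, if_true]
    · simp only [ψ, h, false_and, if_false]
      have h3 : ¬ (φ u t = a ∨ φ u t = b) := fun h' => h ⟨h2, h'⟩
      push Not at h3
      exact (Equiv.swap_apply_of_ne_of_ne h3.1 h3.2).symm
  have hout : ∀ u t, ¬ K.Reachable v u → ψ u t = φ u t := by
    intro u t h1; simp [ψ, h1]
  have hψ : IsEdgeColoring H k ψ := by
    refine ⟨?_, ?_, ?_⟩
    · intro u t
      simp only [ψ, hs u t]
      congr 1
      apply propext
      constructor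
      · rintro ⟨p, r⟩; exact ⟨p.symm, r.trans p.reachable⟩
      · rintro ⟨p, r⟩; exact ⟨p.symm, r.trans p.reachable⟩
    · intro u t hut
      by_cases h : K.Reachable v u
      · rw [hin u t h hut]
        have := hφ.2.1 hut
        simp only [σ, Equiv.swap_apply_def]
        split_ifs
        · exact hb.1
        · exact hva.1
        · exact this
      · rw [hout u t h]; exact hφ.2.1 hut
    · intro u p r hp hr hpr
      by_cases h : K.Reachable v u
      · rw [hin u p h hp, hin u r h hr]
        exact fun h' => hφ.2.2 hp hr hpr (σ.injective h')
      · rw [hout u p h, hout u r h]; exact hφ.2.2 hp hr hpr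
  have hvy : ¬ K.Reachable v y := fun h => hyv h.symm
  have hmo : ∀ u c, ¬ K.Reachable v u → Miss H k φ u c → Miss H k ψ u c := by
    intro u c h h'
    refine ⟨h'.1, fun t ht => ?_⟩
    rw [hout u t h]; exact h'.2 t ht
  have hmn : ∀ u c, c ≠ a → c ≠ b → Miss H k φ u c → Miss H k ψ u c := by
    intro u c ha hb' h'
    by_cases h : K.Reachable v u
    · refine ⟨h'.1, fun t ht => ?_⟩
      rw [hin u t h ht]
      intro he
      have : φ u t = σ c := by rw [← he]; simp [σ]
      rw [show σ c = c from Equiv.swap_apply_of_ne_of_ne ha hb'] at this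
      exact h'.2 t ht this
    · exact hmo u c h h'
  have hreach : ∀ m ≤ n, ∀ u, FanR H k φ x y m u → FanR H k ψ x y m u := by
    intro m
    induction m with
    | zero => intro _ u hu; exact hu
    | succ m ihm =>
      intro hm u hu
      obtain ⟨t, ht, hyu, htc⟩ := hu
      refine ⟨t, ihm (by omega) t ht, hyu, ?_⟩
      rw [hout y u hvy]
      by_cases hc : φ y u = a
      · rw [hc] at htc ⊢
        apply hmo _ _ _ htc
        intro h
        exact hyv ((hminl m (by omega) t ht htc).trans h.symm)
      · exact hmn _ _ hc (hb.2 u hyu) htc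
  refine hA n ψ hψ v (hreach n le_rfl v hv) b ⟨hb.1, fun t ht => ?_⟩ (hmo y b hvy hb)
  rw [hin v t (SimpleGraph.Reachable.refl v) ht]
  intro he
  have : φ v t = σ b := by rw [← he]; simp [σ]
  rw [show σ b = a from Equiv.swap_apply_right a b] at this
  exact hva.2 t ht this

/-- Missing colors as a finset. -/
theorem card_miss {V : Type*} [Fintype V] (H : SimpleGraph V) (k : ℕ) (φ : V → V → ℕ) (v : V)
    (s : Finset V) (hs : ∀ u, H.Adj v u → u ∈ s) :
    ∃ M : Finset ℕ, (∀ c, c ∈ M ↔ Miss H k φ v c) ∧ k ≤ M.card + s.card := by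
  classical
  refine ⟨(Finset.Icc 1 k).filter (fun c => Miss H k φ v c), ?_, ?_⟩
  · intro c
    simp only [Finset.mem_filter]
    exact ⟨fun h => h.2, fun h => ⟨h.1, h⟩⟩
  · have h : Finset.Icc 1 k ⊆ (Finset.Icc 1 k).filter (fun c => Miss H k φ v c) ∪
        s.image (φ v) := by
      intro c hc
      rw [Finset.mem_union, Finset.mem_filter]
      by_cases hm : Miss H k φ v c
      · exact Or.inl ⟨hc, hm⟩
      · right
        have : ∃ u, H.Adj v u ∧ φ v u = c := by
          by_contra hcon
          push Not at hcon
          exact hm ⟨hc, hcon⟩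
        obtain ⟨u, hu, rfl⟩ := this
        exact Finset.mem_image_of_mem _ (hs u hu)
    have h1 := Finset.card_le_card h
    have h2 := Finset.card_union_le ((Finset.Icc 1 k).filter (fun c => Miss H k φ v c))
      (s.image (φ v))
    have h3 : (s.image (φ v)).card ≤ s.card := Finset.card_image_le
    rw [Nat.card_Icc] at h1
    omega

/-- A weak form of Vizing's adjacency lemma. -/
theorem vizing_adjacency {V : Type*} [Fintype V] (G : SimpleGraph V) [DecidableRel G.Adj]
    (hG : IsDeltaCritical G) (x y : V) (hadj : G.Adj y x) :
    G.maxDegree ≤ G.degree x +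
      ((G.neighborFinset y).filter (fun u => G.degree u = G.maxDegree)).card := by
  classical
  obtain ⟨-, hchi, hcrit⟩ := hG
  set k := G.maxDegree with hk
  let H := G.deleteEdges {s(x, y)}
  have hHG : ∀ {u w}, H.Adj u w → G.Adj u w := fun h => (SimpleGraph.deleteEdges_adj.1 h).1
  have hGH : ∀ {u w}, G.Adj u w → s(u, w) ≠ s(x, y) → H.Adj u w := fun h h' =>
    SimpleGraph.deleteEdges_adj.2 ⟨h, h'⟩
  have hHxy : ¬ H.Adj y x := by
    intro h
    exact (SimpleGraph.deleteEdges_adj.1 h).2 (by simp [Sym2.eq_swap])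
  have hxy : x ≠ y := hadj.ne'
  have hno0 : ∀ φ, ¬ IsEdgeColoring G k φ := by
    intro φ hφ
    have : chromIndex G ≤ k := Nat.sInf_le ⟨φ, hφ⟩
    omega
  have hkpos : 0 < k := by
    have h1 := G.degree_le_maxDegree y
    have h2 : 0 < G.degree y := (G.degree_pos_iff_exists_adj y).2 ⟨x, hadj⟩
    omega
  have hH := hcrit s(x, y) hadj.symm
  have hne : {k | ∃ φ : V → V → ℕ, IsEdgeColoring H k φ}.Nonempty := by
    rw [Set.nonempty_iff_ne_empty]
    intro h
    have : chromIndex H = 0 := by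
      unfold chromIndex; rw [h]; exact Nat.sInf_empty
    have h' : chromIndex H = k := hH
    omega
  obtain ⟨φ, hφ⟩ : ∃ φ, IsEdgeColoring H k φ := by
    have := Nat.sInf_mem hne
    rw [show sInf {k | ∃ φ : V → V → ℕ, IsEdgeColoring H k φ} = k from hH] at this
    exact this
  have hno : ∀ φ, IsEdgeColoring H k φ → ∀ c, Miss H k φ x c → ¬ Miss H k φ y c := by
    intro φ hφ c hx hy
    refine hno0 (fun u w => if s(u, w) = s(x, y) then c else φ u w) ⟨?_, ?_, ?_⟩
    · intro u w
      simp only [Sym2.eq_swap (a := u) (b := w), hφ.1 u w]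
    · intro u w huw
      dsimp only
      split_ifs with h
      · exact hx.1
      · exact hφ.2.1 (hGH huw h)
    · intro u p r hp hr hpr
      dsimp only
      have key : ∀ p r, G.Adj u r → p ≠ r → s(u, p) = s(x, y) → φ u r ≠ c ∧
          s(u, r) ≠ s(x, y) := by
        intro p r hr hpr h
        have h4 : s(u, r) ≠ s(x, y) := by
          rw [← h]
          intro h'
          exact hpr (Sym2.congr_right.1 h').symm
        refine ⟨?_, h4⟩
        rcases Sym2.eq_iff.1 h with ⟨rfl, -⟩ | ⟨rfl, -⟩
        · exact hx.2 r (hGH hr h4)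
        · exact hy.2 r (hGH hr h4)
      by_cases h1 : s(u, p) = s(x, y)
      · have := key p r hr hpr h1
        rw [if_pos h1, if_neg this.2]
        exact this.1.symm
      · by_cases h2 : s(u, r) = s(x, y)
        · have := key r p hp hpr.symm h2
          rw [if_pos h2, if_neg h1]
          exact this.1
        · rw [if_neg h1, if_neg h2]
          exact hφ.2.2 (hGH hp h1) (hGH hr h2) hpr
  obtain ⟨b, hb⟩ : ∃ b, Miss H k φ y b := by
    obtain ⟨M, hM, hc⟩ := card_miss H k φ y ((G.neighborFinset y).erase x) (by
      intro u hu
      rw [Finset.mem_erase, SimpleGraph.mem_neighborFinset]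
      exact ⟨by rintro rfl; exact hHxy hu, hHG hu⟩)
    have h1 := G.degree_le_maxDegree y
    have h2 : 0 < G.degree y := (G.degree_pos_iff_exists_adj y).2 ⟨x, hadj⟩
    rw [Finset.card_erase_of_mem (by simpa using hadj), SimpleGraph.card_neighborFinset_eq_degree]
      at hc
    have : 0 < M.card := by omega
    obtain ⟨b, hb⟩ := Finset.card_pos.1 this
    exact ⟨b, (hM b).1 hb⟩
  have hMex : ∀ v, ∃ M : Finset ℕ, (∀ c, c ∈ M ↔ Miss H k φ v c) ∧ k ≤ M.card + G.degree v := by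
    intro v
    have := card_miss H k φ v (G.neighborFinset v) (by
      intro u hu; rw [SimpleGraph.mem_neighborFinset]; exact hHG hu)
    rwa [SimpleGraph.card_neighborFinset_eq_degree] at this
  choose M hM hMc using hMex
  let F : Finset V := Finset.univ.filter (fun v => ∃ n, FanR H k φ x y n v)
  have hF : ∀ v, v ∈ F ↔ ∃ n, FanR H k φ x y n v := by simp [F]
  have hxF : x ∈ F := (hF x).2 ⟨0, rfl⟩
  let B := F.biUnion M
  have hBcard : B.card = ∑ v ∈ F, (M v).card := by
    apply Finset.card_biUnion
    intro z hz w hw hzw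
    rw [Function.onFun, Finset.disjoint_left]
    intro a ha ha'
    obtain ⟨nz, hz⟩ := (hF z).1 hz
    obtain ⟨nw, hw⟩ := (hF w).1 hw
    exact fan_disjoint H k x y hxy hno φ hφ b hb a z w hzw nz nw hz hw
      ((hM _ _).1 ha) ((hM _ _).1 ha')
  let F' := F.erase x
  have hBle : B.card ≤ F'.card := by
    have : B ⊆ F'.image (φ y) := by
      intro c hc
      obtain ⟨v, hv, hvc⟩ := Finset.mem_biUnion.1 hc
      obtain ⟨n, hn⟩ := (hF v).1 hv
      have hvc := (hM _ _).1 hvc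
      have hyc := fan_disjoint_center H k x y hxy hno n φ hφ v hn c hvc
      have : ∃ u, H.Adj y u ∧ φ y u = c := by
        by_contra hcon
        push Not at hcon
        exact hyc ⟨hvc.1, hcon⟩
      obtain ⟨u, hu, rfl⟩ := this
      apply Finset.mem_image_of_mem
      rw [Finset.mem_erase]
      exact ⟨by rintro rfl; exact hHxy hu, (hF u).2 ⟨n + 1, v, hn, hu, hvc⟩⟩
    exact (Finset.card_le_card this).trans Finset.card_image_le
  rw [hBcard, ← Finset.add_sum_erase _ _ hxF] at hBle
  have hsum : (F'.filter (fun u => ¬ G.degree u = k)).card ≤ ∑ v ∈ F', (M v).card := by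
    rw [Finset.card_filter]
    apply Finset.sum_le_sum
    intro v _
    have h1 := G.degree_le_maxDegree v
    have h2 := hMc v
    split_ifs <;> omega
  have hsplit := Finset.card_filter_add_card_filter_not (s := F') (fun u => G.degree u = k)
  have hsub : (F'.filter (fun u => G.degree u = k)).card ≤
      ((G.neighborFinset y).filter (fun u => G.degree u = k)).card := by
    apply Finset.card_le_card
    apply Finset.filter_subset_filter
    intro u hu
    rw [Finset.mem_erase] at hu
    obtain ⟨n, hn⟩ := (hF u).1 hu.2
    cases n with
    | zero => exact absurd hn hu.1
    | succ n =>
      obtain ⟨z, _, h, _⟩ := hn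
      rw [SimpleGraph.mem_neighborFinset]; exact hHG h
  have hx := hMc x
  change (M x).card + ∑ v ∈ F', (M v).card ≤ F'.card at hBle
  omega

/-- Discharging setup: `G` is an `n`-vertex `Δ`-critical graph with minimum degree at least
`d` (`d ∈ {3,4}` or `d ≥ 19`) and `Δ ≥ (d+2)^(5d+10)`, `X` is a maximum independent set,
`Y = V(G) - X`, `ω = 2` if `d ∈ {3,4}` and `ω = ((d-1)d)^(1/3)` if `d ≥ 19`, and
`q = ((d+2-ω)/(d+2))Δ`. Then for each `y ∈ Y` one has `M₂*(y) ≥ 0 = M₂(y)`. -/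
theorem statement14 (G : SimpleGraph V) [DecidableRel G.Adj]
    (d : ℕ) (hd : d = 3 ∨ d = 4 ∨ 19 ≤ d)
    (hG : IsDeltaCritical G) (hmin : ∀ v : V, d ≤ G.degree v)
    (hmax : (d + 2) ^ (5 * d + 10) ≤ G.maxDegree)
    (X : Finset V) (hXind : ∀ u ∈ X, ∀ v ∈ X, u ≠ v → ¬ G.Adj u v)
    (hXmax : ∀ s : Finset V, (∀ u ∈ s, ∀ v ∈ s, u ≠ v → ¬ G.Adj u v) → s.card ≤ X.card)
    (ω : ℝ) (hω : ((d = 3 ∨ d = 4) ∧ ω = 2) ∨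
      (19 ≤ d ∧ ω = (((d : ℝ) - 1) * d) ^ ((1 : ℝ) / 3)))
    (q : ℝ) (hq : q = (((d : ℝ) + 2 - ω) / ((d : ℝ) + 2)) * G.maxDegree)
    (y : V) (hy : y ∉ X) :
    0 ≤ M2starY G d ω q X y := by
  classical
  have hω0 : 0 ≤ ω := by
    rcases hω with ⟨_, h⟩ | ⟨h19, h⟩
    · rw [h]; norm_num
    · rw [h]
      apply Real.rpow_nonneg
      have : (19 : ℝ) ≤ d := by exact_mod_cast h19
      nlinarith
  have hM1 : 0 ≤ M1star G d ω q X y := by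
    unfold M1star
    rw [sub_nonneg]
    set S := G.neighborFinset y ∩ Xp G q X with hS
    rcases S.eq_empty_or_nonempty with h | hne
    · rw [h]; simp only [Finset.sum_empty]; positivity
    obtain ⟨x, hxS, hxmin⟩ := Finset.exists_min_image S (fun v => G.degree v) hne
    have hmem : ∀ v ∈ S, G.Adj y v ∧ q ≤ (G.degree v : ℝ) ∧ G.degree v < G.maxDegree := by
      intro v hv
      rw [hS, Finset.mem_inter, SimpleGraph.mem_neighborFinset, Xp, Finset.mem_filter] at hv
      exact ⟨hv.1, hv.2.2⟩
    obtain ⟨hyx, hqx, hxlt⟩ := hmem x hxS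
    have hval := vizing_adjacency G hG x y hyx
    have hSle : S.card ≤ G.degree x := by
      have hdisj : Disjoint S
          ((G.neighborFinset y).filter (fun u => G.degree u = G.maxDegree)) := by
        rw [Finset.disjoint_left]
        intro v hv hv'
        have := (hmem v hv).2.2
        have := (Finset.mem_filter.1 hv').2
        omega
      have hsub : S ∪ ((G.neighborFinset y).filter (fun u => G.degree u = G.maxDegree)) ⊆
          G.neighborFinset y :=
        Finset.union_subset (Finset.inter_subset_left) (Finset.filter_subset _ _)
      have h1 := Finset.card_le_card hsub
      rw [Finset.card_union_of_disjoint hdisj, SimpleGraph.card_neighborFinset_eq_degree] at h1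
      have := G.degree_le_maxDegree y
      omega
    have hd3 : 0 < d := by omega
    have hxpos : (0 : ℝ) < G.degree x := by
      have := hmin x
      exact_mod_cast (by omega : 0 < G.degree x)
    have hle : (G.degree x : ℝ) ≤ G.maxDegree := by exact_mod_cast hxlt.le
    have hterm : ∀ v ∈ S, g1 d (G.maxDegree : ℝ) (G.degree v : ℝ) ≤
        ((d : ℝ) + 2) * (G.maxDegree - G.degree x) / G.degree x := by
      intro v hv
      have h1 : (G.degree x : ℝ) ≤ G.degree v := by exact_mod_cast hxmin v hv
      have h2 : (G.degree v : ℝ) ≤ G.maxDegree := by exact_mod_cast (hmem v hv).2.2.le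
      unfold g1
      apply div_le_div₀
      · exact mul_nonneg (by positivity) (by linarith)
      · exact mul_le_mul_of_nonneg_left (by linarith) (by positivity)
      · exact hxpos
      · exact h1
    have hnn : 0 ≤ ((d : ℝ) + 2) * (G.maxDegree - G.degree x) / G.degree x :=
      div_nonneg (mul_nonneg (by positivity) (by linarith)) hxpos.le
    calc ∑ v ∈ S, g1 d (G.maxDegree : ℝ) (G.degree v : ℝ)
        ≤ S.card • (((d : ℝ) + 2) * (G.maxDegree - G.degree x) / G.degree x) :=
          Finset.sum_le_card_nsmul _ _ _ hterm
      _ = (S.card : ℝ) * (((d : ℝ) + 2) * (G.maxDegree - G.degree x) / G.degree x) := by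
          rw [nsmul_eq_mul]
      _ ≤ (G.degree x : ℝ) * (((d : ℝ) + 2) * (G.maxDegree - G.degree x) / G.degree x) :=
          mul_le_mul_of_nonneg_right (by exact_mod_cast hSle) hnn
      _ = ((d : ℝ) + 2) * (G.maxDegree - G.degree x) := by
          field_simp
      _ ≤ ((d : ℝ) + 2) * (G.maxDegree - q) :=
          mul_le_mul_of_nonneg_left (by linarith) (by positivity)
      _ = ω * G.maxDegree := by
          rw [hq]
          have : (d : ℝ) + 2 ≠ 0 := by positivity
          field_simp
          ring
  unfold M2starY step2
  split_ifs with h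
  · have hc : ((G.neighborFinset y ∩ Xm G d q X).card : ℝ) ≠ 0 := by
      have := Finset.card_pos.2 h.2
      exact_mod_cast this.ne'
    rw [mul_div_cancel₀ _ hc]
    simp
  · simpa using hM1
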